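/- Let A be a Banach algebra with a bounded approximate identity. If every continuous derivation from A into the dual of a neo-unital Banach A-bimodule is boundedly weak*-approximately inner, then every continuous derivation from A into the dual of any Banach A-bimodule is boundedly weak*-approximately inner; consequently A is approximately amenable. -/

import Mathlib

open Filter Topology MeasureTheory

/-- A Banach bimodule structure over a (not necessarily unital) normed algebra `A`.
`l a x` is the left action `a • x` and `r a x` is the right action `x • a`. -/
structure BBimod (A X : Type*) [NonUnitalNormedRing A] [NormedSpace ℂ A]
    [NormedAddCommGroup X] [NormedSpace ℂ X] where
  l : A →L[ℂ] X →L[ℂ] X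
  r : A →L[ℂ] X →L[ℂ] X
  l_mul : ∀ a b x, l (a * b) x = l a (l b x)
  r_mul : ∀ a b x, r (a * b) x = r b (r a x)
  lr : ∀ a b x, l a (r b x) = r b (l a x)

namespace BBimod

variable {A X : Type*} [NonUnitalNormedRing A] [NormedSpace ℂ A]
    [NormedAddCommGroup X] [NormedSpace ℂ X]

/-- The dual bimodule structure on `X →L[ℂ] ℂ`:
`(a • f) x = f (x • a)` and `(f • a) x = f (a • x)`. -/
noncomputable def dual (M : BBimod A X) : BBimod A (X →L[ℂ] ℂ) where
  l := (ContinuousLinearMap.compL ℂ X X ℂ).flip.comp M.r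
  r := (ContinuousLinearMap.compL ℂ X X ℂ).flip.comp M.l
  l_mul := by intro a b f; ext x; simp [M.r_mul a b x]
  r_mul := by intro a b f; ext x; simp [M.l_mul a b x]
  lr := by intro a b f; ext x; simp [M.lr]

/-- `D` is a derivation: `D (a b) = a • D b + D a • b`. -/
def IsDeriv (M : BBimod A X) (D : A →L[ℂ] X) : Prop :=
  ∀ a b, D (a * b) = M.l a (D b) + M.r b (D a)

/-- `D` is inner: `D a = a • x - x • a` for some `x`. -/
def IsInner (M : BBimod A X) (D : A →L[ℂ] X) : Prop :=
  ∃ x, ∀ a, D a = M.l a x - M.r a x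

/-- `D` is approximately inner: a net of inner derivations converges to `D`
in the strong operator topology. -/
def IsApproxInner (M : BBimod A X) (D : A →L[ℂ] X) : Prop :=
  ∃ (ι : Type) (lf : Filter ι) (x : ι → X), lf.NeBot ∧
    ∀ a, Tendsto (fun i => M.l a (x i) - M.r a (x i)) lf (𝓝 (D a))

/-- `D` is boundedly approximately inner: the approximating net of inner derivations
is uniformly bounded in operator norm. -/
def IsBddApproxInner (M : BBimod A X) (D : A →L[ℂ] X) : Prop :=
  ∃ (ι : Type) (lf : Filter ι) (x : ι → X) (K : ℝ), lf.NeBot ∧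
    (∀ i a, ‖M.l a (x i) - M.r a (x i)‖ ≤ K * ‖a‖) ∧
    ∀ a, Tendsto (fun i => M.l a (x i) - M.r a (x i)) lf (𝓝 (D a))

/-- `D` is approximately semi-inner: `D a = lim_i (a • m i - n i • a)`. -/
def IsApproxSemiInner (M : BBimod A X) (D : A →L[ℂ] X) : Prop :=
  ∃ (ι : Type) (lf : Filter ι) (m n : ι → X), lf.NeBot ∧
    ∀ a, Tendsto (fun i => M.l a (m i) - M.r a (n i)) lf (𝓝 (D a))

/-- The bimodule `X` is neo-unital: `X = A • X • A`. -/
def NeoUnital (M : BBimod A X) : Prop :=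
  ∀ x : X, ∃ a b y, x = M.l a (M.r b y)

/-- A derivation into the dual module is boundedly weak*-approximately inner. -/
def IsBddWeakStarApproxInner (M : BBimod A X) (D : A →L[ℂ] (X →L[ℂ] ℂ)) : Prop :=
  ∃ (ι : Type) (lf : Filter ι) (f : ι → (X →L[ℂ] ℂ)) (K : ℝ), lf.NeBot ∧
    (∀ i, ‖f i‖ ≤ K) ∧
    ∀ (a : A) (x : X),
      Tendsto (fun i => (M.dual.l a (f i) - M.dual.r a (f i)) x) lf (𝓝 (D a x))

end BBimod

/-- A Banach algebra is approximately amenable if every continuous derivation into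
the dual of a Banach bimodule is approximately inner. -/
def ApproxAmenable (A : Type*) [NonUnitalNormedRing A] [NormedSpace ℂ A] : Prop :=
  ∀ (X : Type) [NormedAddCommGroup X] [NormedSpace ℂ X] [CompleteSpace X]
    (M : BBimod A X) (D : A →L[ℂ] (X →L[ℂ] ℂ)),
    M.dual.IsDeriv D → M.dual.IsApproxInner D

/-- A Banach algebra is boundedly approximately amenable if every continuous derivation
into the dual of a Banach bimodule is boundedly approximately inner. -/
def BddApproxAmenable (A : Type*) [NonUnitalNormedRing A] [NormedSpace ℂ A] : Prop :=
  ∀ (X : Type) [NormedAddCommGroup X] [NormedSpace ℂ X] [CompleteSpace X]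
    (M : BBimod A X) (D : A →L[ℂ] (X →L[ℂ] ℂ)),
    M.dual.IsDeriv D → M.dual.IsBddApproxInner D

/-- A Banach algebra is boundedly approximately contractible if every continuous
derivation into any Banach bimodule is boundedly approximately inner. -/
def BddApproxContractible (A : Type*) [NonUnitalNormedRing A] [NormedSpace ℂ A] : Prop :=
  ∀ (X : Type) [NormedAddCommGroup X] [NormedSpace ℂ X] [CompleteSpace X]
    (M : BBimod A X) (D : A →L[ℂ] X),
    M.IsDeriv D → M.IsBddApproxInner D

/-- A Banach algebra is amenable if every continuous derivation into the dual of a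
Banach bimodule is inner. -/
def Amenable (A : Type*) [NonUnitalNormedRing A] [NormedSpace ℂ A] : Prop :=
  ∀ (X : Type) [NormedAddCommGroup X] [NormedSpace ℂ X] [CompleteSpace X]
    (M : BBimod A X) (D : A →L[ℂ] (X →L[ℂ] ℂ)),
    M.dual.IsDeriv D → M.dual.IsInner D

/-- `A` has a bounded (two-sided) approximate identity. -/
def HasBAI (A : Type*) [NonUnitalNormedRing A] : Prop :=
  ∃ (ι : Type) (lf : Filter ι) (e : ι → A) (K : ℝ), lf.NeBot ∧
    (∀ i, ‖e i‖ ≤ K) ∧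
    ∀ a : A, Tendsto (fun i => e i * a) lf (𝓝 a) ∧ Tendsto (fun i => a * e i) lf (𝓝 a)

/-- A witness that the Banach algebra `C` is (isometrically isomorphic to) the projective
tensor product `A ⊗̂ B`: a contractive bilinear multiplicative map with dense span satisfying
the universal property of the projective tensor norm. -/
structure ProjTensor (A B C : Type*) [NonUnitalNormedRing A] [NormedSpace ℂ A]
    [NonUnitalNormedRing B] [NormedSpace ℂ B]
    [NonUnitalNormedRing C] [NormedSpace ℂ C] where
  tp : A →L[ℂ] B →L[ℂ] C
  mk_mul : ∀ a a' b b', tp (a * a') (b * b') = tp a b * tp a' b'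
  norm_mk_le : ∀ a b, ‖tp a b‖ ≤ ‖a‖ * ‖b‖
  dense_span : Dense
    ((Submodule.span ℂ (Set.range fun p : A × B => tp p.1 p.2) : Submodule ℂ C) : Set C)
  lift : ∀ (E : Type) [NormedAddCommGroup E] [NormedSpace ℂ E] [CompleteSpace E]
    (φ : A →L[ℂ] B →L[ℂ] E), ∃ T : C →L[ℂ] E, ‖T‖ ≤ ‖φ‖ ∧ ∀ a b, T (tp a b) = φ a b

/-- A witness that the Banach space `T` is the projective tensor product `E ⊗̂ F`
of Banach spaces. -/
structure ProjTensorSp (E F T : Type*) [NormedAddCommGroup E] [NormedSpace ℂ E]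
    [NormedAddCommGroup F] [NormedSpace ℂ F]
    [NormedAddCommGroup T] [NormedSpace ℂ T] where
  tp : E →L[ℂ] F →L[ℂ] T
  norm_mk_le : ∀ e f, ‖tp e f‖ ≤ ‖e‖ * ‖f‖
  dense_span : Dense
    ((Submodule.span ℂ (Set.range fun p : E × F => tp p.1 p.2) : Submodule ℂ T) : Set T)
  lift : ∀ (W : Type) [NormedAddCommGroup W] [NormedSpace ℂ W] [CompleteSpace W]
    (φ : E →L[ℂ] F →L[ℂ] W), ∃ S : T →L[ℂ] W, ‖S‖ ≤ ‖φ‖ ∧ ∀ e f, S (tp e f) = φ e f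

/-- A witness that the unital Banach algebra `A'` is the unitization `A#` of `A`. -/
structure IsUnitization (A A' : Type*) [NonUnitalNormedRing A] [NormedSpace ℂ A]
    [NormedRing A'] [NormedAlgebra ℂ A'] where
  ι : A →L[ℂ] A'
  ι_mul : ∀ a b, ι (a * b) = ι a * ι b
  ι_norm : ∀ a, ‖ι a‖ = ‖a‖
  decomp : ∀ x : A', ∃! p : ℂ × A, x = algebraMap ℂ A' p.1 + ι p.2

/-- Joint continuity of evaluation, along filters. -/
theorem tendsto_act {A X Z : Type*} [NormedAddCommGroup A] [NormedSpace ℂ A]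
    [NormedAddCommGroup X] [NormedSpace ℂ X] [NormedAddCommGroup Z] [NormedSpace ℂ Z]
    (T : A →L[ℂ] X →L[ℂ] Z) {κ : Type*} {l : Filter κ} {u : κ → A} {v : κ → X} {a : A} {x : X}
    (hu : Tendsto u l (𝓝 a)) (hv : Tendsto v l (𝓝 x)) :
    Tendsto (fun i => T (u i) (v i)) l (𝓝 (T a x)) :=
  (T.continuous₂.tendsto (a, x)).comp (hu.prodMk_nhds hv)

/-- Cohen factorization for a module action. -/
theorem cohen_factor {A X : Type*} [NormedAddCommGroup A] [NormedSpace ℂ A] [CompleteSpace A]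
    [NormedAddCommGroup X] [NormedSpace ℂ X] [CompleteSpace X]
    (T : A →L[ℂ] X →L[ℂ] X) (m : A → A → A) (hm : ∀ a b x, T (m a b) x = T a (T b x))
    {ι : Type} (lf : Filter ι) [lf.NeBot] (e : ι → A) (K : ℝ) (hK : ∀ i, ‖e i‖ ≤ K)
    (he : ∀ a, Tendsto (fun i => m a (e i)) lf (𝓝 a))
    (hx : ∀ x, Tendsto (fun i => T (e i) x) lf (𝓝 x)) (x : X) :
    ∃ a y, x = T a y := by
  obtain ⟨i0⟩ : Nonempty ι := lf.nonempty_of_neBot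
  have hK0 : 0 ≤ K := (norm_nonneg _).trans (hK i0)
  set M : ℝ := 1 + ‖T‖ * K with hM
  have hM1 : 1 ≤ M := by
    have := mul_nonneg (norm_nonneg T) hK0
    linarith
  set c : ℝ := 1 / (2 * M) with hc
  have hc0 : 0 < c := by positivity
  have hc1 : c ≤ 1 / 2 := by
    rw [hc, div_le_div_iff₀ (by positivity) (by norm_num)]; linarith
  have hcM : c * M = 1 / 2 := by rw [hc]; field_simp
  -- inverses
  have hinv : ∀ i y, ∃ z, z - (c : ℂ) • (z - T (e i) z) = y ∧ ‖z - y‖ ≤ ‖y - T (e i) y‖ := by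
    intro i y
    set L : X →L[ℂ] X := (c : ℂ) • (ContinuousLinearMap.id ℂ X - T (e i)) with hL
    have hLn : ‖L‖ ≤ 1 / 2 := by
      rw [hL, norm_smul, ← hcM]
      have h1 : ‖ContinuousLinearMap.id ℂ X - T (e i)‖ ≤ M :=
        (norm_sub_le _ _).trans (add_le_add ContinuousLinearMap.norm_id_le
          ((T.le_opNorm _).trans (mul_le_mul_of_nonneg_left (hK i) (norm_nonneg _))))
      rw [Complex.norm_real, Real.norm_of_nonneg hc0.le]
      exact mul_le_mul_of_nonneg_left h1 hc0.le
    let u := Units.oneSub L (by linarith)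
    have hu : ∀ y, (u : X →L[ℂ] X) ((↑u⁻¹ : X →L[ℂ] X) y) = y := by
      intro y
      rw [← ContinuousLinearMap.mul_apply, Units.mul_inv]; rfl
    refine ⟨(↑u⁻¹ : X →L[ℂ] X) y, ?_, ?_⟩
    · exact hu y
    · set z := (↑u⁻¹ : X →L[ℂ] X) y
      have hz : z - L z = y := hu y
      have h1 : z - y = L (z - y) + L y := by rw [map_sub, ← hz]; simp
      have h2 : ‖L (z - y)‖ ≤ 1 / 2 * ‖z - y‖ :=
        (L.le_opNorm _).trans (mul_le_mul_of_nonneg_right hLn (norm_nonneg _))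
      have h3 : ‖L y‖ ≤ 1 / 2 * ‖y - T (e i) y‖ := by
        have : L y = (c : ℂ) • (y - T (e i) y) := by simp [hL]
        rw [this, norm_smul, Complex.norm_real, Real.norm_of_nonneg hc0.le]
        exact mul_le_mul_of_nonneg_right hc1 (norm_nonneg _)
      have h4 := norm_add_le (L (z - y)) (L y)
      rw [← h1] at h4
      linarith
  choose S hS1 hS2 using hinv
  have hch : ∀ (n : ℕ) (p : A × X), ∃ i, ‖m p.1 (e i) - p.1‖ ≤ (1 / 2 : ℝ) ^ n ∧
      ‖p.2 - T (e i) p.2‖ ≤ (1 / 2 : ℝ) ^ n := by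
    intro n p
    have hp : (0 : ℝ) < (1 / 2 : ℝ) ^ n := by positivity
    have h1 := (Metric.tendsto_nhds.1 (he p.1)) _ hp
    have h2 := (Metric.tendsto_nhds.1 (hx p.2)) _ hp
    obtain ⟨i, h1, h2⟩ := (h1.and h2).exists
    refine ⟨i, ?_, ?_⟩
    · rw [← dist_eq_norm]; exact h1.le
    · rw [← dist_eq_norm, dist_comm]; exact h2.le
  choose j hj1 hj2 using hch
  let step : ℕ → A × X → A × X := fun n p =>
    (p.1 + (c : ℂ) • (m p.1 (e (j n p)) - p.1) + ((1 - c : ℂ) ^ n * c) • e (j n p),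
      S (j n p) p.2)
  let s : ℕ → A × X := fun n => Nat.rec (0, x) (fun n p => step n p) n
  have hs : ∀ n, s (n + 1) = step n (s n) := fun n => rfl
  have hinvar : ∀ n, x = T (s n).1 (s n).2 + ((1 - c : ℂ) ^ n) • (s n).2 := by
    intro n
    induction n with
    | zero => simp [s]
    | succ n ih =>
      rw [hs]
      simp only [step]
      set p := s n
      set z := S (j n p) p.2
      have hz : z - (c : ℂ) • (z - T (e (j n p)) z) = p.2 := hS1 _ _
      rw [← hz] at ih
      rw [ih]
      simp only [map_add, map_sub, map_smul, ContinuousLinearMap.add_apply,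
        ContinuousLinearMap.sub_apply, ContinuousLinearMap.smul_apply, hm]
      module
  have h1c : ‖(1 - c : ℂ)‖ = 1 - c := by
    rw [← Complex.ofReal_one, ← Complex.ofReal_sub, Complex.norm_real, Real.norm_of_nonneg]
    linarith
  have hb : ∀ n, dist (s n).1 (s (n + 1)).1 ≤ (1 / 2 : ℝ) ^ n + (1 - c) ^ n * K := by
    intro n
    rw [hs, dist_comm, dist_eq_norm]
    simp only [step]
    rw [add_assoc, add_sub_cancel_left]
    refine (norm_add_le _ _).trans (add_le_add ?_ ?_)
    · rw [norm_smul, Complex.norm_real, Real.norm_of_nonneg hc0.le]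
      calc _ ≤ 1 * (1 / 2 : ℝ) ^ n :=
            mul_le_mul (by linarith) (hj1 _ _) (norm_nonneg _) zero_le_one
        _ = _ := one_mul _
    · rw [norm_smul, norm_mul, norm_pow, h1c, Complex.norm_real, Real.norm_of_nonneg hc0.le]
      have : 0 ≤ (1 - c) ^ n := pow_nonneg (by linarith) n
      refine mul_le_mul ?_ (hK _) (norm_nonneg _) this
      nlinarith
  have hy : ∀ n, dist (s n).2 (s (n + 1)).2 ≤ (1 / 2 : ℝ) ^ n := by
    intro n
    rw [hs, dist_comm, dist_eq_norm]
    exact (hS2 _ _).trans (hj2 _ _)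
  have hg : Summable (fun n : ℕ => (1 / 2 : ℝ) ^ n) := summable_geometric_two
  have hg2 : Summable (fun n : ℕ => (1 - c) ^ n) :=
    summable_geometric_of_lt_one (by linarith) (by linarith)
  obtain ⟨a, ha⟩ := cauchySeq_tendsto_of_complete
    (cauchySeq_of_dist_le_of_summable _ hb (hg.add (hg2.mul_right K)))
  obtain ⟨y, hy'⟩ := cauchySeq_tendsto_of_complete
    (cauchySeq_of_dist_le_of_summable _ hy hg)
  refine ⟨a, y, ?_⟩
  have hT : Tendsto (fun n => T (s n).1 (s n).2) atTop (𝓝 (T a y)) :=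
    tendsto_act T ha hy'
  have hp : Tendsto (fun n : ℕ => (1 - c : ℂ) ^ n) atTop (𝓝 0) :=
    tendsto_pow_atTop_nhds_zero_of_norm_lt_one (by rw [h1c]; linarith)
  have hlim := hT.add (hp.smul hy')
  rw [zero_smul, add_zero] at hlim
  exact tendsto_nhds_unique (tendsto_const_nhds.congr hinvar) hlim

/-- Ultrafilter weak-star limits of bounded families of functionals. -/
theorem exists_ultralimit {X : Type*} [NormedAddCommGroup X] [NormedSpace ℂ X]
    {ι : Type} (U : Ultrafilter ι) (F : ι → (X →L[ℂ] ℂ)) (K : ℝ) (hK : ∀ i, ‖F i‖ ≤ K) :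
    ∃ h : X →L[ℂ] ℂ, ∀ x, Tendsto (fun i => F i x) U (𝓝 (h x)) := by
  have hpt : ∀ x, ∃ z : ℂ, Tendsto (fun i => F i x) U (𝓝 z) ∧ ‖z‖ ≤ K * ‖x‖ := by
    intro x
    have hc := isCompact_closedBall (0 : ℂ) (K * ‖x‖)
    obtain ⟨z, hz, hlim⟩ := hc.ultrafilter_le_nhds (U.map fun i => F i x) (by
      rw [le_principal_iff]
      refine Filter.mem_map.2 (Filter.univ_mem' fun i => ?_)
      simp only [Set.mem_preimage, mem_closedBall_zero_iff]
      exact ((F i).le_opNorm x).trans (mul_le_mul_of_nonneg_right (hK i) (norm_nonneg _)))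
    exact ⟨z, hlim, by simpa using hz⟩
  choose h h1 h2 using hpt
  refine ⟨LinearMap.mkContinuous
    { toFun := h
      map_add' := fun x y => tendsto_nhds_unique (h1 (x + y))
        (((h1 x).add (h1 y)).congr fun i => (map_add (F i) x y).symm)
      map_smul' := fun r x => tendsto_nhds_unique (h1 (r • x))
        (((h1 x).const_smul r).congr fun i => (map_smul (F i) r x).symm) } K h2, h1⟩

/-- The submodule on which a bounded family of operators converges pointwise to the identity. -/
def fixSub {X : Type*} [NormedAddCommGroup X] [NormedSpace ℂ X]
    {ι : Type} (lf : Filter ι) (P : ι → (X →L[ℂ] X)) : Submodule ℂ X where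
  carrier := {x | Tendsto (fun i => P i x) lf (𝓝 x)}
  add_mem' := by
    intro x y hx hy
    exact (Tendsto.add hx hy).congr fun i => (map_add (P i) x y).symm
  zero_mem' := by
    show Tendsto (fun i => P i 0) lf (𝓝 0)
    simp only [map_zero]
    exact tendsto_const_nhds
  smul_mem' := by
    intro r x hx
    exact (Tendsto.const_smul hx r).congr fun i => (map_smul (P i) r x).symm

theorem mem_fixSub {X : Type*} [NormedAddCommGroup X] [NormedSpace ℂ X]
    {ι : Type} {lf : Filter ι} {P : ι → (X →L[ℂ] X)} {x : X} :
    x ∈ fixSub lf P ↔ Tendsto (fun i => P i x) lf (𝓝 x) := Iff.rfl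

theorem isClosed_fixSub {X : Type*} [NormedAddCommGroup X] [NormedSpace ℂ X]
    {ι : Type} (lf : Filter ι) (P : ι → (X →L[ℂ] X)) (C : ℝ) (hC : ∀ i, ‖P i‖ ≤ C) :
    IsClosed (fixSub lf P : Set X) := by
  rw [← isSeqClosed_iff_isClosed]
  intro u x hu hux
  show Tendsto (fun i => P i x) lf (𝓝 x)
  rw [Metric.tendsto_nhds]
  intro ε hε
  set C' := max C 0
  have hC' : 0 ≤ C' := le_max_right _ _
  have hδ : 0 < ε / (C' + 2) := by positivity
  obtain ⟨n, hn⟩ := ((Metric.tendsto_nhds.1 hux) _ hδ).exists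
  have h2 := (Metric.tendsto_nhds.1 (hu n)) _ hδ
  filter_upwards [h2] with i hi
  have h3 : dist (P i x) (P i (u n)) ≤ C' * dist (u n) x := by
    rw [dist_eq_norm, ← map_sub, dist_comm, dist_eq_norm]
    exact ((P i).le_opNorm _).trans
      (mul_le_mul_of_nonneg_right ((hC i).trans (le_max_left _ _)) (norm_nonneg _))
  have h4 : C' * dist (u n) x ≤ C' * (ε / (C' + 2)) :=
    mul_le_mul_of_nonneg_left hn.le hC'
  have h5 : dist (P i x) x ≤ dist (P i x) (P i (u n)) + dist (P i (u n)) (u n) + dist (u n) x :=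
    dist_triangle4 _ _ _ _
  have h6 : C' * (ε / (C' + 2)) + ε / (C' + 2) + ε / (C' + 2) = ε := by field_simp; ring
  linarith

/-- Restriction of an action to an invariant submodule. -/
noncomputable def restrAct {A X : Type*} [NormedAddCommGroup A] [NormedSpace ℂ A]
    [NormedAddCommGroup X] [NormedSpace ℂ X] (T : A →L[ℂ] X →L[ℂ] X) (Y : Submodule ℂ X)
    (h : ∀ a, ∀ y ∈ Y, T a y ∈ Y) : A →L[ℂ] Y →L[ℂ] Y :=
  LinearMap.mkContinuous₂
    (LinearMap.mk₂ ℂ (fun a (y : Y) => (⟨T a y, h a y y.2⟩ : Y))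
      (by intros; ext; simp) (by intros; ext; simp) (by intros; ext; simp)
      (by intros; ext; simp)) ‖T‖ (by
        intro a y
        exact T.le_opNorm₂ a (y : X))

@[simp] theorem restrAct_coe {A X : Type*} [NormedAddCommGroup A] [NormedSpace ℂ A]
    [NormedAddCommGroup X] [NormedSpace ℂ X] (T : A →L[ℂ] X →L[ℂ] X) (Y : Submodule ℂ X)
    (h : ∀ a, ∀ y ∈ Y, T a y ∈ Y) (a : A) (y : Y) : (restrAct T Y h a y : X) = T a y := rfl

theorem BBimod.dual_l_apply {A X : Type*} [NonUnitalNormedRing A] [NormedSpace ℂ A]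
    [NormedAddCommGroup X] [NormedSpace ℂ X] (M : BBimod A X) (a : A) (f : X →L[ℂ] ℂ) (x : X) :
    M.dual.l a f x = f (M.r a x) := rfl

theorem BBimod.dual_r_apply {A X : Type*} [NonUnitalNormedRing A] [NormedSpace ℂ A]
    [NormedAddCommGroup X] [NormedSpace ℂ X] (M : BBimod A X) (a : A) (f : X →L[ℂ] ℂ) (x : X) :
    M.dual.r a f x = f (M.l a x) := rfl

/-- Boundedly weak-star approximately inner derivations are inner (Banach-Alaoglu). -/
theorem BBimod.inner_of_bddWeakStar {A X : Type*} [NonUnitalNormedRing A] [NormedSpace ℂ A]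
    [NormedAddCommGroup X] [NormedSpace ℂ X] (M : BBimod A X) (D : A →L[ℂ] (X →L[ℂ] ℂ))
    (h : M.IsBddWeakStarApproxInner D) : M.dual.IsInner D := by
  obtain ⟨ι, lf, f, K, hne, hK, hlim⟩ := h
  obtain ⟨g, hg⟩ := exists_ultralimit (Ultrafilter.of lf) f K hK
  refine ⟨g, fun a => ?_⟩
  ext x
  refine tendsto_nhds_unique ((hlim a x).mono_left (Ultrafilter.of_le lf)) ?_
  exact (hg (M.r a x)).sub (hg (M.l a x))

/-- A derivation vanishing on `A X A` is inner. -/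
theorem BBimod.inner_of_vanish {A X : Type*} [NonUnitalNormedRing A] [NormedSpace ℂ A]
    [NormedAddCommGroup X] [NormedSpace ℂ X] (hbai : HasBAI A) (M : BBimod A X)
    (D : A →L[ℂ] (X →L[ℂ] ℂ)) (hD : M.dual.IsDeriv D)
    (h0 : ∀ a b c x, D a (M.l b (M.r c x)) = 0) : M.dual.IsInner D := by
  obtain ⟨ι, lf, e, K, hne, hK, he⟩ := hbai
  set U := Ultrafilter.of lf
  have hU : (U : Filter ι) ≤ lf := Ultrafilter.of_le lf
  have hd : ∀ a b x, D (a * b) x = D b (M.r a x) + D a (M.l b x) := by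
    intro a b x
    rw [hD a b]; rfl
  obtain ⟨h, hh⟩ := exists_ultralimit U (fun i => D (e i)) (‖D‖ * K) (fun i =>
    (D.le_opNorm _).trans (mul_le_mul_of_nonneg_left (hK i) (norm_nonneg _)))
  obtain ⟨P, hP⟩ := exists_ultralimit U (fun i => h.comp (M.l (e i))) (‖h‖ * (‖M.l‖ * K))
    (fun i => (h.opNorm_comp_le _).trans (mul_le_mul_of_nonneg_left
      ((M.l.le_opNorm _).trans (mul_le_mul_of_nonneg_left (hK i) (norm_nonneg _)))
      (norm_nonneg _)))
  have hY : ∀ b c x, h (M.l b (M.r c x)) = 0 := by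
    intro b c x
    refine tendsto_nhds_unique (hh _) ?_
    simp only [h0]
    exact tendsto_const_nhds
  -- continuity facts
  have hDc : ∀ (u : ι → A) (a : A) (x : X), Tendsto u lf (𝓝 a) →
      Tendsto (fun i => D (u i) x) U (𝓝 (D a x)) := by
    intro u a x hu
    exact tendsto_act D (hu.mono_left hU) tendsto_const_nhds
  have hR : ∀ a x, Tendsto (fun i => D a (M.r (e i) x)) U (𝓝 (D a x - h (M.l a x))) := by
    intro a x
    have h1 := (hDc _ a x (he a).1).sub (hh (M.l a x))
    refine h1.congr fun i => ?_
    rw [hd]; ring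
  have hL : ∀ a x, Tendsto (fun i => D a (M.l (e i) x)) U (𝓝 (D a x - h (M.r a x))) := by
    intro a x
    have h1 := (hDc _ a x (he a).2).sub (hh (M.r a x))
    refine h1.congr fun i => ?_
    rw [hd]; ring
  have hLe : ∀ a b x, D a (M.l b x) = h (M.l a (M.l b x)) := by
    intro a b x
    have h1 := hR a (M.l b x)
    have h2 : (fun i => D a (M.r (e i) (M.l b x))) = fun _ => 0 := by
      funext i
      rw [← M.lr, h0]
    rw [h2] at h1
    have := tendsto_nhds_unique h1 tendsto_const_nhds
    exact sub_eq_zero.1 this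
  have hlc : ∀ (u : ι → A) (a : A) (x : X), Tendsto u lf (𝓝 a) →
      Tendsto (fun i => h (M.l (u i) x)) U (𝓝 (h (M.l a x))) := by
    intro u a x hu
    exact (h.continuous.tendsto _).comp
      (tendsto_act M.l (hu.mono_left hU) tendsto_const_nhds)
  have hmain : ∀ a x, D a x = h (M.r a x) + h (M.l a x) := by
    intro a x
    have h1 := hL a x
    have h2 : Tendsto (fun i => D a (M.l (e i) x)) U (𝓝 (h (M.l a x))) := by
      refine (hlc _ a x (he a).2).congr fun i => ?_
      rw [hLe, M.l_mul]
    have := tendsto_nhds_unique h1 h2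
    rw [← this]; ring
  have hPl : ∀ a x, P (M.l a x) = h (M.l a x) := by
    intro a x
    refine tendsto_nhds_unique (hP _) ?_
    refine (hlc _ a x (he a).1).congr fun i => ?_
    rw [M.l_mul]; rfl
  have hPr : ∀ a x, P (M.r a x) = 0 := by
    intro a x
    refine tendsto_nhds_unique (hP _) ?_
    simp only [ContinuousLinearMap.comp_apply, hY]
    exact tendsto_const_nhds
  refine ⟨h - (2 : ℂ) • P, fun a => ?_⟩
  ext x
  rw [ContinuousLinearMap.sub_apply, M.dual_l_apply, M.dual_r_apply]
  simp only [ContinuousLinearMap.sub_apply, ContinuousLinearMap.smul_apply, hPl, hPr, hmain,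
    smul_eq_mul]
  ring

/-- if `A` has a bounded approximate identity and every continuous
derivation from `A` into the dual of a *neo-unital* Banach bimodule is boundedly
weak*-approximately inner, then the same holds for duals of arbitrary Banach
bimodules, and consequently `A` is approximately amenable. -/
theorem bddWeakStarApproxInner_of_neoUnital_case
    {A : Type*} [NonUnitalNormedRing A] [NormedSpace ℂ A] [CompleteSpace A]
    (hbai : HasBAI A)
    (hneo : ∀ (X : Type) [NormedAddCommGroup X] [NormedSpace ℂ X] [CompleteSpace X]
      (M : BBimod A X), M.NeoUnital → ∀ D : A →L[ℂ] (X →L[ℂ] ℂ),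
      M.dual.IsDeriv D → M.IsBddWeakStarApproxInner D) :
    (∀ (X : Type) [NormedAddCommGroup X] [NormedSpace ℂ X] [CompleteSpace X]
      (M : BBimod A X) (D : A →L[ℂ] (X →L[ℂ] ℂ)),
      M.dual.IsDeriv D → M.IsBddWeakStarApproxInner D) ∧
    ApproxAmenable A := by
  have key : ∀ (X : Type) [NormedAddCommGroup X] [NormedSpace ℂ X] [CompleteSpace X]
      (M : BBimod A X) (D : A →L[ℂ] (X →L[ℂ] ℂ)),
      M.dual.IsDeriv D → M.dual.IsInner D := by
    intro X _ _ _ M D hD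
    obtain ⟨ι, lf, e, K, hne, hK, he⟩ := id hbai
    have hbd : ∀ (T : A →L[ℂ] X →L[ℂ] X) i, ‖T (e i)‖ ≤ ‖T‖ * K := fun T i =>
      (T.le_opNorm _).trans (mul_le_mul_of_nonneg_left (hK i) (norm_nonneg _))
    have hcont : ∀ (T : A →L[ℂ] X →L[ℂ] X) (u : ι → A) (a : A) (x : X), Tendsto u lf (𝓝 a) →
        Tendsto (fun i => T (u i) x) lf (𝓝 (T a x)) := fun T u a x hu =>
      tendsto_act T hu tendsto_const_nhds
    let Y : Submodule ℂ X := fixSub lf (fun i => M.l (e i)) ⊓ fixSub lf (fun i => M.r (e i))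
    have hYc : IsClosed (Y : Set X) :=
      (isClosed_fixSub lf _ _ (hbd M.l)).inter (isClosed_fixSub lf _ _ (hbd M.r))
    haveI : CompleteSpace Y := hYc.completeSpace_coe
    have hLl : ∀ a x, M.l a x ∈ fixSub lf (fun i => M.l (e i)) := fun a x =>
      mem_fixSub.2 ((hcont M.l _ a x (he a).1).congr fun i => M.l_mul _ _ _)
    have hRr : ∀ a x, M.r a x ∈ fixSub lf (fun i => M.r (e i)) := fun a x =>
      mem_fixSub.2 ((hcont M.r _ a x (he a).2).congr fun i => M.r_mul _ _ _)
    have hl : ∀ a, ∀ y ∈ Y, M.l a y ∈ Y := by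
      intro a y hy
      refine ⟨hLl a y, mem_fixSub.2 ?_⟩
      exact (((M.l a).continuous.tendsto _).comp (mem_fixSub.1 hy.2)).congr fun i => M.lr _ _ _
    have hr : ∀ a, ∀ y ∈ Y, M.r a y ∈ Y := by
      intro a y hy
      refine ⟨mem_fixSub.2 ?_, hRr a y⟩
      exact (((M.r a).continuous.tendsto _).comp (mem_fixSub.1 hy.1)).congr
        fun i => (M.lr _ _ _).symm
    have hAXA : ∀ b c x, M.l b (M.r c x) ∈ Y := by
      intro b c x
      refine ⟨hLl _ _, ?_⟩
      rw [M.lr]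
      exact hRr _ _
    let N : BBimod A Y :=
      { l := restrAct M.l Y hl
        r := restrAct M.r Y hr
        l_mul := fun a b x => Subtype.ext (M.l_mul a b x)
        r_mul := fun a b x => Subtype.ext (M.r_mul a b x)
        lr := fun a b x => Subtype.ext (M.lr a b x) }
    have hN : N.NeoUnital := by
      intro y
      obtain ⟨a, z, hz⟩ := cohen_factor N.l (fun a b => a * b) N.l_mul lf e K hK
        (fun a => (he a).2) (fun y => tendsto_subtype_rng.2 (mem_fixSub.1 y.2.1)) y
      obtain ⟨b, w, hw⟩ := cohen_factor N.r (fun a b => b * a) (fun a b x => N.r_mul b a x)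
        lf e K hK (fun a => (he a).1) (fun y => tendsto_subtype_rng.2 (mem_fixSub.1 y.2.2)) z
      exact ⟨a, b, w, by rw [← hw, ← hz]⟩
    let DY : A →L[ℂ] (Y →L[ℂ] ℂ) :=
      ((ContinuousLinearMap.compL ℂ Y X ℂ).flip Y.subtypeL).comp D
    have hDY : N.dual.IsDeriv DY := by
      intro a b
      ext y
      exact congrArg (fun f : X →L[ℂ] ℂ => f (y : X)) (hD a b)
    obtain ⟨g, hg⟩ := N.inner_of_bddWeakStar DY (hneo Y N hN DY hDY)
    obtain ⟨G, hG, -⟩ := exists_extension_norm_eq Y g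
    let D' : A →L[ℂ] (X →L[ℂ] ℂ) := D - (M.dual.l.flip G - M.dual.r.flip G)
    have hD'a : ∀ a x, D' a x = D a x - (G (M.r a x) - G (M.l a x)) := fun a x => rfl
    have hD' : M.dual.IsDeriv D' := by
      intro a b
      ext x
      have h1 : D (a * b) x = D b (M.r a x) + D a (M.l b x) := by rw [hD a b]; rfl
      rw [ContinuousLinearMap.add_apply, M.dual_l_apply, M.dual_r_apply, hD'a, hD'a, hD'a, h1,
        M.r_mul, M.l_mul, M.lr]
      ring
    have hv : ∀ a b c x, D' a (M.l b (M.r c x)) = 0 := by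
      intro a b c x
      let y : Y := ⟨M.l b (M.r c x), hAXA b c x⟩
      have h1 : DY a y = g (N.r a y) - g (N.l a y) := by rw [hg a]; rfl
      rw [← hG, ← hG] at h1
      rw [hD'a]
      exact sub_eq_zero.2 h1
    obtain ⟨f, hf⟩ := M.inner_of_vanish hbai D' hD' hv
    refine ⟨f + G, fun a => ?_⟩
    ext x
    have h1 : D' a x = f (M.r a x) - f (M.l a x) := by rw [hf a]; rfl
    rw [hD'a] at h1
    rw [ContinuousLinearMap.sub_apply, M.dual_l_apply, M.dual_r_apply,
      ContinuousLinearMap.add_apply, ContinuousLinearMap.add_apply]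
    linear_combination h1
  refine ⟨fun X _ _ _ M D hD => ?_, fun X _ _ _ M D hD => ?_⟩
  · obtain ⟨f, hf⟩ := key X M D hD
    refine ⟨Unit, ⊤, fun _ => f, ‖f‖, inferInstance, fun _ => le_rfl, fun a x => ?_⟩
    rw [hf a]
    exact tendsto_const_nhds
  · obtain ⟨f, hf⟩ := key X M D hD
    refine ⟨Unit, ⊤, fun _ => f, inferInstance, fun a => ?_⟩
    rw [hf a]
    exact tendsto_const_nhds
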